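/- Let 0 < s < 1, Λ, δ > 0, and T = L(Λ+1)δ for some positive integer L. The minimizers of ℱ^T_s over 𝒜^{T,Λ,δ} are exactly the functions x ↦ ū(x − x₀) + y₀ with x₀, y₀ ∈ ℝ; in particular every minimizer is periodic with the minimal period (Λ+1)δ. -/

import Mathlib

open MeasureTheory Filter Set Topology

noncomputable section

/-- A function `u : ℝ → ℝ` is piecewise affine: it is affine in a neighborhood of every
point outside a closed discrete set (the corner set). -/
def PiecewiseAffine (u : ℝ → ℝ) : Prop :=
  ∃ S : Set ℝ, IsClosed S ∧ (∀ x ∈ S, ∃ ε > 0, S ∩ Set.Ioo (x - ε) (x + ε) ⊆ {x}) ∧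
    ∀ x ∉ S, ∃ ε > 0, ∃ m q : ℝ, ∀ y : ℝ, |y - x| < ε → u y = m * y + q

/-- The admissible class `𝒜^{T,Λ,δ}`: continuous, `T`-periodic, piecewise affine functions
with slope in `{1, -Λ}` a.e., such that the region where the slope is `-Λ` is a union of
intervals of length `δ` whose pairwise intersections contain at most one point. -/
structure Admissible (T Λ δ : ℝ) (u : ℝ → ℝ) : Prop where
  cont : Continuous u
  per : Function.Periodic u T
  pwAffine : PiecewiseAffine u
  slopes : ∀ᵐ x : ℝ ∂volume, HasDerivAt u 1 x ∨ HasDerivAt u (-Λ) x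
  negRegion : ∃ a : ℕ → ℝ,
    (∀ k : ℕ, Set.Ioo (a k) (a k + δ) ⊆ {x : ℝ | HasDerivAt u (-Λ) x}) ∧
    ({x : ℝ | HasDerivAt u (-Λ) x} ⊆ ⋃ k : ℕ, Set.Icc (a k) (a k + δ)) ∧
    (Pairwise fun i j : ℕ =>
      (Set.Icc (a i) (a i + δ) ∩ Set.Icc (a j) (a j + δ)).Subsingleton)

/-- The `s`-fractional Gagliardo seminorm energy density
`ℱ^T_s(u) = (1/(2T)) ∫_0^T ∫_ℝ |u(x)-u(y)|²/|x-y|^{1+2s} dy dx`. -/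
def Fs (s T : ℝ) (u : ℝ → ℝ) : ℝ :=
  (1 / (2 * T)) * ∫ x in Set.Ioo (0 : ℝ) T, ∫ y : ℝ, (u x - u y) ^ 2 / |x - y| ^ (1 + 2 * s)

/-- The `s`-fractional Laplacian
`(-Δ)^s u (x) = 2 lim_{r→0⁺} ∫_{ℝ∖(x-r,x+r)} (u(x)-u(y))/|x-y|^{1+2s} dy`. -/
def fracLap (s : ℝ) (u : ℝ → ℝ) (x : ℝ) : ℝ :=
  limUnder (𝓝[>] (0 : ℝ)) fun r : ℝ =>
    2 * ∫ y in {y : ℝ | r ≤ |x - y|}, (u x - u y) / |x - y| ^ (1 + 2 * s)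

/-- The function `ū`: the `(Λ+1)δ`-periodic function equal to `-Λx` on `(-δ,0)` and to
`x` on `[0,Λδ]`. -/
def ubar (Λ δ : ℝ) (x : ℝ) : ℝ :=
  let y := ((Λ + 1) * δ) * Int.fract ((x + δ) / ((Λ + 1) * δ)) - δ
  if y < 0 then -Λ * y else y

/-- The extremal energy for `s = 0`: `ℱ^T_0(u) = (1/(2T)) ∫_0^T |u(x)|² dx`. -/
def F0 (T : ℝ) (u : ℝ → ℝ) : ℝ :=
  (1 / (2 * T)) * ∫ x in Set.Ioo (0 : ℝ) T, (u x) ^ 2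

/-- The extremal energy for `s = 1`: `ℱ^T_1(u) = (1/(2T)) ∫_0^T |u'(x)|² dx`. -/
def F1 (T : ℝ) (u : ℝ → ℝ) : ℝ :=
  (1 / (2 * T)) * ∫ x in Set.Ioo (0 : ℝ) T, (deriv u x) ^ 2

/-- The centred indicator of `[0, δ) + Tℤ`: the `T`-periodic step function with mean zero equal to
`1 - δ / T` on `[0, δ)` and to `-δ / T` on `[δ, T)`. -/
def blockSlope (T δ x : ℝ) : ℝ := (if Int.fract (x / T) < δ / T then 1 else 0) - δ / T

/-- The `T`-periodic primitive of `blockSlope`. -/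
def block (T δ x : ℝ) : ℝ := ∫ z in (0 : ℝ)..x, blockSlope T δ z

/-- The increment of `block` with step `h`. -/
def blockIncr (T δ h x : ℝ) : ℝ := block T δ (x + h) - block T δ x

/-- The autocorrelation over a period of the increments of `block`. -/
def blockCorr (T δ h t : ℝ) : ℝ :=
  ∫ x in (0 : ℝ)..T, blockIncr T δ h (x + t) * blockIncr T δ h x

section Periodic

variable {f : ℝ → ℝ} {T : ℝ}

lemma periodic_integral_comp_add (hf : Function.Periodic f T) (c : ℝ) :
    ∫ x in (0 : ℝ)..T, f (x + c) = ∫ x in (0 : ℝ)..T, f x := by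
  rw [intervalIntegral.integral_comp_add_right]
  have := hf.intervalIntegral_add_eq c 0
  simpa [add_comm] using this

lemma periodic_primitive (hf : Function.Periodic f T) (hc : ∀ a b, IntervalIntegrable f volume a b)
    (h0 : ∫ x in (0 : ℝ)..T, f x = 0) :
    Function.Periodic (fun x => ∫ z in (0 : ℝ)..x, f z) T := by
  intro x
  have h := hf.intervalIntegral_add_eq x 0
  rw [zero_add, h0] at h
  have := intervalIntegral.integral_add_adjacent_intervals (hc 0 x) (hc x (x + T))
  simp only [← this, h, add_zero]

end Periodic

section Block

variable {T δ : ℝ}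

lemma blockSlope_periodic (hT : 0 < T) : Function.Periodic (blockSlope T δ) T := by
  intro x
  have : (x + T) / T = x / T + 1 := by field_simp
  simp only [blockSlope, this, Int.fract_add_one]

lemma measurable_blockSlope : Measurable (blockSlope T δ) := by
  unfold blockSlope
  refine Measurable.sub_const (Measurable.ite ?_ measurable_const measurable_const) _
  exact measurableSet_lt (measurable_fract.comp (measurable_id.div_const T)) measurable_const

lemma neg_le_blockSlope (x : ℝ) : -(δ / T) ≤ blockSlope T δ x := by
  unfold blockSlope; split_ifs <;> linarith

lemma abs_blockSlope_le (hδ : 0 < δ) (hδT : δ < T) (x : ℝ) : |blockSlope T δ x| ≤ 1 := by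
  have h1 : 0 < δ / T := div_pos hδ (hδ.trans hδT)
  have h2 : δ / T < 1 := (div_lt_one (hδ.trans hδT)).2 hδT
  unfold blockSlope
  rw [abs_le]
  split_ifs <;> constructor <;> linarith

lemma blockSlope_of_mem_Ico_left (hδT : δ < T) {x : ℝ} (hx : x ∈ Ico 0 δ) :
    blockSlope T δ x = 1 - δ / T := by
  have hT : 0 < T := by linarith [hx.1, hx.2]
  have : Int.fract (x / T) = x / T :=
    Int.fract_eq_self.2 ⟨div_nonneg hx.1 hT.le, (div_lt_one hT).2 (hx.2.trans hδT)⟩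
  rw [blockSlope, this, if_pos (div_lt_div_of_pos_right hx.2 hT)]

lemma blockSlope_of_mem_Ico_right (hδ : 0 < δ) {x : ℝ} (hx : x ∈ Ico δ T) :
    blockSlope T δ x = -(δ / T) := by
  have hT : 0 < T := by linarith [hx.1, hx.2]
  have : Int.fract (x / T) = x / T :=
    Int.fract_eq_self.2 ⟨div_nonneg (hδ.le.trans hx.1) hT.le, (div_lt_one hT).2 hx.2⟩
  rw [blockSlope, this, if_neg (not_lt.2 (div_le_div_of_nonneg_right hx.1 hT.le)), zero_sub]

lemma blockSlope_of_mem_Ico_neg (hδ : 0 < δ) (hδT : δ < T) {x : ℝ} (hx : x ∈ Ico (δ - T) 0) :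
    blockSlope T δ x = -(δ / T) := by
  rw [← blockSlope_periodic (hδ.trans hδT) x]
  exact blockSlope_of_mem_Ico_right hδ ⟨by linarith [hx.1], by linarith [hx.2]⟩

lemma intervalIntegrable_blockSlope (hδ : 0 < δ) (hδT : δ < T) (a b : ℝ) :
    IntervalIntegrable (blockSlope T δ) volume a b :=
  (intervalIntegrable_const (c := (1 : ℝ))).mono_fun
    measurable_blockSlope.aestronglyMeasurable
    (Eventually.of_forall fun x => by simpa using abs_blockSlope_le hδ hδT x)

lemma block_sub (hδ : 0 < δ) (hδT : δ < T) (x y : ℝ) :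
    block T δ y - block T δ x = ∫ z in x..y, blockSlope T δ z :=
  intervalIntegral.integral_interval_sub_left (intervalIntegrable_blockSlope hδ hδT _ _)
    (intervalIntegrable_blockSlope hδ hδT _ _)

lemma integral_eq_of_eqOn_Ioo {f : ℝ → ℝ} {x y c : ℝ} (hxy : x ≤ y)
    (h : ∀ z ∈ Ioo x y, f z = c) : ∫ z in x..y, f z = c * (y - x) := by
  rw [intervalIntegral.integral_of_le hxy, integral_Ioc_eq_integral_Ioo,
    setIntegral_congr_fun measurableSet_Ioo h]
  simp [hxy, mul_comm]

lemma block_sub_of_le_left (hδ : 0 < δ) (hδT : δ < T) {x y : ℝ} (hx : 0 ≤ x) (hxy : x ≤ y)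
    (hy : y ≤ δ) : block T δ y - block T δ x = (1 - δ / T) * (y - x) := by
  rw [block_sub hδ hδT]
  exact integral_eq_of_eqOn_Ioo hxy fun z hz =>
    blockSlope_of_mem_Ico_left hδT ⟨by linarith [hz.1], by linarith [hz.2]⟩

lemma block_sub_of_le_right (hδ : 0 < δ) (hδT : δ < T) {x y : ℝ} (hx : δ ≤ x) (hxy : x ≤ y)
    (hy : y ≤ T) : block T δ y - block T δ x = -(δ / T) * (y - x) := by
  rw [block_sub hδ hδT]
  exact integral_eq_of_eqOn_Ioo hxy fun z hz =>
    blockSlope_of_mem_Ico_right hδ ⟨by linarith [hz.1], by linarith [hz.2]⟩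

lemma block_zero : block T δ 0 = 0 := by simp [block]

lemma integral_blockSlope_period (hδ : 0 < δ) (hδT : δ < T) :
    ∫ x in (0 : ℝ)..T, blockSlope T δ x = 0 := by
  have h1 := block_sub_of_le_left hδ hδT le_rfl hδ.le le_rfl
  have h2 := block_sub_of_le_right hδ hδT le_rfl hδT.le le_rfl
  have h3 := block_sub hδ hδT 0 T
  have hT : T ≠ 0 := (hδ.trans hδT).ne'
  rw [← h3, ← sub_add_sub_cancel, h1, h2]
  field_simp
  ring

lemma block_periodic (hδ : 0 < δ) (hδT : δ < T) : Function.Periodic (block T δ) T :=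
  periodic_primitive (blockSlope_periodic (hδ.trans hδT)) (intervalIntegrable_blockSlope hδ hδT)
    (integral_blockSlope_period hδ hδT)

lemma abs_block_sub_le (hδ : 0 < δ) (hδT : δ < T) (x y : ℝ) :
    |block T δ y - block T δ x| ≤ |y - x| := by
  rw [block_sub hδ hδT]
  simpa using intervalIntegral.norm_integral_le_of_norm_le_const (a := x) (b := y) (C := 1)
    (f := blockSlope T δ) fun z _ => abs_blockSlope_le hδ hδT z

lemma continuous_block (hδ : 0 < δ) (hδT : δ < T) : Continuous (block T δ) :=
  intervalIntegral.continuous_primitive (intervalIntegrable_blockSlope hδ hδT) 0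

lemma le_block_sub (hδ : 0 < δ) (hδT : δ < T) {x y : ℝ} (hxy : x ≤ y) :
    -(δ / T) * (y - x) ≤ block T δ y - block T δ x := by
  rw [block_sub hδ hδT]
  have := intervalIntegral.integral_mono_on hxy
    (intervalIntegrable_const (c := -(δ / T))) (intervalIntegrable_blockSlope hδ hδT _ _)
    (fun z _ => neg_le_blockSlope z)
  rwa [intervalIntegral.integral_const, smul_eq_mul, mul_comm] at this

lemma block_window_ge (hδ : 0 < δ) (hδT : δ < T) (x : ℝ) :
    -(δ / T) * δ ≤ block T δ (x + δ) - block T δ x := by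
  simpa using le_block_sub hδ hδT (show x ≤ x + δ by linarith)

lemma block_window_eq (hδ : 0 < δ) (hδT : δ < T) {x : ℝ} (hx : x ∈ Icc δ (T - δ)) :
    block T δ (x + δ) - block T δ x = -(δ / T) * δ := by
  rw [block_sub_of_le_right hδ hδT hx.1 (by linarith) (by linarith [hx.2])]
  ring

lemma block_window_gt (hδ : 0 < δ) (hδT : δ < T) {x : ℝ} (hx : |x| < δ) :
    -(δ / T) * δ < block T δ (x + δ) - block T δ x := by
  rw [abs_lt] at hx
  have hT : 0 < T := hδ.trans hδT
  have hlt : δ / T < 1 := (div_lt_one hT).2 hδT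
  rcases le_total 0 x with h | h
  · have h1 := block_sub_of_le_left hδ hδT h hx.2.le le_rfl
    have h2 := le_block_sub hδ hδT (show δ ≤ x + δ by linarith)
    nlinarith
  · have h1 := block_sub_of_le_left hδ hδT (le_refl 0) (by linarith : (0 : ℝ) ≤ x + δ)
      (by linarith)
    have h2 := le_block_sub hδ hδT h
    nlinarith

/-- Integration by parts against `block` over a period. -/
lemma integral_mul_block (hδ : 0 < δ) (hδT : δ < T) {V v : ℝ → ℝ} (hv : Continuous v)
    (hV : ∀ x, HasDerivAt V (v x) x) (hV0 : ∫ x in (0 : ℝ)..T, V x = 0) :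
    ∫ x in (0 : ℝ)..T, v x * block T δ x = -∫ x in (0 : ℝ)..δ, V x := by
  have hT : 0 < T := hδ.trans hδT
  have hVc : Continuous V := continuous_iff_continuousAt.2 fun x => (hV x).continuousAt
  have hbc := continuous_block hδ hδT
  have key : ∀ (a b c d : ℝ), a ≤ b → (∀ x ∈ Icc a b, block T δ x = c * x + d) →
      ∫ x in a..b, v x * block T δ x
        = V b * block T δ b - V a * block T δ a - c * ∫ x in a..b, V x := by
    intro a b c d hab hx
    have h1 : ∫ x in a..b, v x * block T δ x = ∫ x in a..b, (c * x + d) * v x :=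
      intervalIntegral.integral_congr fun x hx' => by
        rw [uIcc_of_le hab] at hx'
        simp only [hx x hx', mul_comm]
    rw [h1, intervalIntegral.integral_mul_deriv_eq_deriv_mul (u' := fun _ => c) (v := V)
      (fun x _ => by simpa using ((hasDerivAt_id x).const_mul c).add_const d)
      (fun x _ => hV x) intervalIntegrable_const (hv.intervalIntegrable _ _),
      intervalIntegral.integral_const_mul, hx a (left_mem_Icc.2 hab), hx b (right_mem_Icc.2 hab)]
    ring
  have hδv : block T δ δ = (1 - δ / T) * δ := by
    simpa [block_zero] using block_sub_of_le_left hδ hδT le_rfl hδ.le le_rfl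
  have hTv : block T δ T = 0 := by
    simpa [block_zero] using block_periodic hδ hδT 0
  have k1 := key 0 δ (1 - δ / T) 0 hδ.le fun x hx => by
    simpa [block_zero] using block_sub_of_le_left hδ hδT le_rfl hx.1 hx.2
  have k2 := key δ T (-(δ / T)) δ hδT.le fun x hx => by
    have := block_sub_of_le_right hδ hδT le_rfl hx.1 hx.2
    linear_combination this + hδv
  have s1 := intervalIntegral.integral_add_adjacent_intervals (μ := volume)
    (f := fun x => v x * block T δ x) (a := 0) (b := δ) (c := T)
    ((hv.mul hbc).intervalIntegrable _ _) ((hv.mul hbc).intervalIntegrable _ _)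
  have s2 := intervalIntegral.integral_add_adjacent_intervals (μ := volume)
    (f := V) (a := 0) (b := δ) (c := T)
    (hVc.intervalIntegrable _ _) (hVc.intervalIntegrable _ _)
  rw [← s1, k1, k2, hTv, block_zero]
  rw [hV0] at s2
  linear_combination (δ / T) * s2

end Block

section Corr

variable {T δ : ℝ}

lemma continuous_blockIncr (hδ : 0 < δ) (hδT : δ < T) (h : ℝ) : Continuous (blockIncr T δ h) := by
  have := continuous_block hδ hδT
  unfold blockIncr
  fun_prop

lemma blockIncr_periodic (hδ : 0 < δ) (hδT : δ < T) (h : ℝ) :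
    Function.Periodic (blockIncr T δ h) T := by
  intro x
  rw [blockIncr, blockIncr, block_periodic hδ hδT, add_right_comm, block_periodic hδ hδT]

lemma integral_blockIncr (hδ : 0 < δ) (hδT : δ < T) (h : ℝ) :
    ∫ x in (0 : ℝ)..T, blockIncr T δ h x = 0 := by
  have hc := continuous_block hδ hδT
  unfold blockIncr
  rw [intervalIntegral.integral_sub (Continuous.intervalIntegrable (by fun_prop) _ _)
    (hc.intervalIntegrable _ _), periodic_integral_comp_add (block_periodic hδ hδT), sub_self]

/-- The `T`-periodic primitive of `blockIncr`. -/
def blockIncrPrimitive (T δ h x : ℝ) : ℝ := ∫ z in (0 : ℝ)..x, blockIncr T δ h z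

lemma hasDerivAt_blockIncrPrimitive (hδ : 0 < δ) (hδT : δ < T) (h x : ℝ) :
    HasDerivAt (blockIncrPrimitive T δ h) (blockIncr T δ h x) x :=
  (continuous_blockIncr hδ hδT h).integral_hasStrictDerivAt 0 x |>.hasDerivAt

lemma continuous_blockIncrPrimitive (hδ : 0 < δ) (hδT : δ < T) (h : ℝ) :
    Continuous (blockIncrPrimitive T δ h) :=
  continuous_iff_continuousAt.2 fun x => (hasDerivAt_blockIncrPrimitive hδ hδT h x).continuousAt

lemma blockIncrPrimitive_periodic (hδ : 0 < δ) (hδT : δ < T) (h : ℝ) :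
    Function.Periodic (blockIncrPrimitive T δ h) T :=
  periodic_primitive (blockIncr_periodic hδ hδT h)
    (fun _ _ => (continuous_blockIncr hδ hδT h).intervalIntegrable _ _)
    (integral_blockIncr hδ hδT h)

/-- The derivative of `blockCorr`. -/
def blockCorrDeriv (T δ h t : ℝ) : ℝ :=
  blockIncrPrimitive T δ h (t + δ) - blockIncrPrimitive T δ h t
    - (blockIncrPrimitive T δ h (t + (δ - h)) - blockIncrPrimitive T δ h (t + -h))

lemma blockCorr_eq (hδ : 0 < δ) (hδT : δ < T) (h t : ℝ) :
    blockCorr T δ h t = ∫ x in (0 : ℝ)..δ,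
      (blockIncrPrimitive T δ h (x + t) - blockIncrPrimitive T δ h (x + (t - h))) := by
  have hw := continuous_blockIncr hδ hδT h
  have hb := continuous_block hδ hδT
  have hW := continuous_blockIncrPrimitive hδ hδT h
  have hp := blockIncr_periodic hδ hδT h
  have hbp := block_periodic hδ hδT
  have hWp := blockIncrPrimitive_periodic hδ hδT h
  have e1 : blockCorr T δ h t
      = (∫ x in (0 : ℝ)..T, blockIncr T δ h (x + t) * block T δ (x + h))
        - ∫ x in (0 : ℝ)..T, blockIncr T δ h (x + t) * block T δ x := by
    rw [← intervalIntegral.integral_sub (Continuous.intervalIntegrable (by fun_prop) _ _)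
      (Continuous.intervalIntegrable (by fun_prop) _ _)]
    refine intervalIntegral.integral_congr fun x _ => ?_
    simp only [blockIncr]
    ring
  have hper : Function.Periodic (fun x => blockIncr T δ h (x + (t - h)) * block T δ x) T := by
    intro x
    simp only [add_right_comm x T, hp _, hbp _]
  have e2 : ∫ x in (0 : ℝ)..T, blockIncr T δ h (x + t) * block T δ (x + h)
      = ∫ x in (0 : ℝ)..T, blockIncr T δ h (x + (t - h)) * block T δ x := by
    rw [← periodic_integral_comp_add hper h]
    refine intervalIntegral.integral_congr fun x _ => ?_
    simp only [add_assoc, add_sub_cancel]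
  have e3 := integral_mul_block hδ hδT
    (V := fun x => blockIncrPrimitive T δ h (x + (t - h)) - blockIncrPrimitive T δ h (x + t))
    (v := fun x => blockIncr T δ h (x + (t - h)) - blockIncr T δ h (x + t)) (by fun_prop)
    (fun x => ((hasDerivAt_blockIncrPrimitive hδ hδT h _).comp_add_const x (t - h)).sub
      ((hasDerivAt_blockIncrPrimitive hδ hδT h _).comp_add_const x t))
    (by
      rw [intervalIntegral.integral_sub (Continuous.intervalIntegrable (by fun_prop) _ _)
        (Continuous.intervalIntegrable (by fun_prop) _ _),
        periodic_integral_comp_add hWp, periodic_integral_comp_add hWp, sub_self])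
  rw [e1, e2, ← intervalIntegral.integral_sub (Continuous.intervalIntegrable (by fun_prop) _ _)
      (Continuous.intervalIntegrable (by fun_prop) _ _)]
  simp only [← sub_mul]
  rw [e3, ← intervalIntegral.integral_neg]
  simp only [neg_sub]

lemma hasDerivAt_blockCorr (hδ : 0 < δ) (hδT : δ < T) (h t : ℝ) :
    HasDerivAt (blockCorr T δ h) (blockCorrDeriv T δ h t) t := by
  have hW := continuous_blockIncrPrimitive hδ hδT h
  have hP : ∀ x, HasDerivAt (fun y => ∫ z in (0 : ℝ)..y, blockIncrPrimitive T δ h z)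
      (blockIncrPrimitive T δ h x) x := fun x => (hW.integral_hasStrictDerivAt 0 x).hasDerivAt
  set P : ℝ → ℝ := fun y => ∫ z in (0 : ℝ)..y, blockIncrPrimitive T δ h z with hPdef
  have e : blockCorr T δ h
      = fun t => (P (t + δ) - P t) - (P (t + (δ - h)) - P (t + (-h))) := by
    funext t
    rw [blockCorr_eq hδ hδT, intervalIntegral.integral_sub
      (Continuous.intervalIntegrable (by fun_prop) _ _)
      (Continuous.intervalIntegrable (by fun_prop) _ _),
      intervalIntegral.integral_comp_add_right, intervalIntegral.integral_comp_add_right]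
    simp only [hPdef]
    rw [intervalIntegral.integral_interval_sub_left (hW.intervalIntegrable _ _)
      (hW.intervalIntegrable _ _), intervalIntegral.integral_interval_sub_left
      (hW.intervalIntegrable _ _) (hW.intervalIntegrable _ _)]
    congr 2 <;> ring
  rw [e]
  have := (((hP (t + δ)).comp_add_const t δ).sub (hP t)).sub
    (((hP (t + (δ - h))).comp_add_const t (δ - h)).sub ((hP (t + (-h))).comp_add_const t (-h)))
  exact this

lemma hasDerivAt_blockCorrDeriv (hδ : 0 < δ) (hδT : δ < T) (h t : ℝ) :
    HasDerivAt (blockCorrDeriv T δ h)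
      ((block T δ (t + h + δ) - block T δ (t + h)) + (block T δ (t - h + δ) - block T δ (t - h))
        - 2 * (block T δ (t + δ) - block T δ t)) t := by
  have hP := hasDerivAt_blockIncrPrimitive hδ hδT h
  have := (((hP (t + δ)).comp_add_const t δ).sub (hP t)).sub
    (((hP (t + (δ - h))).comp_add_const t (δ - h)).sub ((hP (t + (-h))).comp_add_const t (-h)))
  refine HasDerivAt.congr_deriv this ?_
  simp only [blockIncr]
  ring_nf

lemma blockCorrDeriv_monotoneOn (hδ : 0 < δ) (hδT : δ < T) (h : ℝ) :
    MonotoneOn (blockCorrDeriv T δ h) (Icc δ (T - δ)) := by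
  have hd := hasDerivAt_blockCorrDeriv hδ hδT h
  refine monotoneOn_of_deriv_nonneg (convex_Icc _ _)
    (fun x _ => (hd x).continuousAt.continuousWithinAt)
    (fun x _ => (hd x).differentiableAt.differentiableWithinAt) fun x hx => ?_
  rw [(hd x).deriv, block_window_eq hδ hδT (interior_subset hx)]
  linarith [block_window_ge hδ hδT (x + h), block_window_ge hδ hδT (x - h)]

lemma blockCorrDeriv_lt (hδ : 0 < δ) (hδT : δ < T) {h d x y : ℝ} (hd : d ∈ Icc δ (T - δ))
    (hdh : |d - h| < δ) (hx : x ∈ Icc δ (T - δ)) (hy : y ∈ Icc δ (T - δ)) (hxy : x < y)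
    (hxd : x ≤ d) (hdy : d ≤ y) :
    blockCorrDeriv T δ h x < blockCorrDeriv T δ h y := by
  have hD := hasDerivAt_blockCorrDeriv hδ hδT h
  rw [abs_lt] at hdh
  have hmono := blockCorrDeriv_monotoneOn hδ hδT h
  set x' := max x (h - δ) with hx'
  set y' := min y (h + δ) with hy'
  have hx'd : x' ≤ d := max_le hxd (by linarith)
  have hdy' : d ≤ y' := le_min hdy (by linarith)
  have hlt : x' < y' := by
    refine max_lt (lt_min hxy (by linarith)) (lt_min (by linarith) (by linarith))
  have hxx' : x ≤ x' := le_max_left _ _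
  have hyy' : y' ≤ y := min_le_left _ _
  have hx'm : x' ∈ Icc δ (T - δ) := ⟨hx.1.trans hxx', by linarith [hd.2]⟩
  have hy'm : y' ∈ Icc δ (T - δ) := ⟨by linarith [hd.1], hyy'.trans hy.2⟩
  have hstrict : StrictMonoOn (blockCorrDeriv T δ h) (Icc x' y') := by
    refine strictMonoOn_of_deriv_pos (convex_Icc _ _)
      (fun x _ => (hD x).continuousAt.continuousWithinAt) fun z hz => ?_
    rw [interior_Icc] at hz
    have h1 : h - δ ≤ x' := le_max_right _ _
    have h2 : y' ≤ h + δ := min_le_right _ _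
    rw [(hD z).deriv, block_window_eq hδ hδT (x := z)
      ⟨by linarith [hz.1, hx'm.1], by linarith [hz.2, hy'm.2]⟩]
    have := block_window_gt hδ hδT (x := z - h)
      (abs_lt.2 ⟨by linarith [hz.1], by linarith [hz.2]⟩)
    linarith [block_window_ge hδ hδT (z + h)]
  calc _ ≤ _ := hmono hx hx'm hxx'
    _ < _ := hstrict (left_mem_Icc.2 hlt.le) (right_mem_Icc.2 hlt.le) hlt
    _ ≤ _ := hmono hy'm hy hyy'

/-- `blockCorr` lies above its tangent lines on `[δ, T - δ]`. -/
lemma blockCorr_tangent_le (hδ : 0 < δ) (hδT : δ < T) (h : ℝ) {d x : ℝ}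
    (hd : d ∈ Icc δ (T - δ)) (hx : x ∈ Icc δ (T - δ)) :
    blockCorr T δ h d + blockCorrDeriv T δ h d * (x - d) ≤ blockCorr T δ h x := by
  have hD := hasDerivAt_blockCorr hδ hδT h
  have hmono := blockCorrDeriv_monotoneOn hδ hδT h
  rcases lt_trichotomy d x with hlt | rfl | hlt
  · obtain ⟨c, hc, hceq⟩ := exists_hasDerivAt_eq_slope _ _ hlt
      (fun z _ => (hD z).continuousAt.continuousWithinAt) (fun z _ => hD z)
    have := hmono hd ⟨by linarith [hd.1, hc.1], by linarith [hx.2, hc.2]⟩ hc.1.le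
    rw [hceq, le_div_iff₀ (by linarith)] at this
    linarith
  · simp
  · obtain ⟨c, hc, hceq⟩ := exists_hasDerivAt_eq_slope _ _ hlt
      (fun z _ => (hD z).continuousAt.continuousWithinAt) (fun z _ => hD z)
    have := hmono ⟨by linarith [hx.1, hc.1], by linarith [hd.2, hc.2]⟩ hd hc.2.le
    rw [hceq, div_le_iff₀ (by linarith)] at this
    linarith

lemma blockCorr_tangent_lt (hδ : 0 < δ) (hδT : δ < T) {h d x : ℝ}
    (hd : d ∈ Icc δ (T - δ)) (hx : x ∈ Icc δ (T - δ)) (hdh : |d - h| < δ) (hne : x ≠ d) :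
    blockCorr T δ h d + blockCorrDeriv T δ h d * (x - d) < blockCorr T δ h x := by
  have hD := hasDerivAt_blockCorr hδ hδT h
  rcases hne.lt_or_gt with hlt | hlt
  · obtain ⟨c, hc, hceq⟩ := exists_hasDerivAt_eq_slope _ _ hlt
      (fun z _ => (hD z).continuousAt.continuousWithinAt) (fun z _ => hD z)
    have := blockCorrDeriv_lt hδ hδT hd hdh ⟨by linarith [hx.1, hc.1], by linarith [hd.2, hc.2]⟩
      hd hc.2 hc.2.le le_rfl
    rw [hceq, div_lt_iff₀ (by linarith)] at this
    linarith
  · obtain ⟨c, hc, hceq⟩ := exists_hasDerivAt_eq_slope _ _ hlt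
      (fun z _ => (hD z).continuousAt.continuousWithinAt) (fun z _ => hD z)
    have := blockCorrDeriv_lt hδ hδT hd hdh hd ⟨by linarith [hd.1, hc.1], by linarith [hx.2, hc.2]⟩
      hc.1 le_rfl hc.1.le
    rw [hceq, lt_div_iff₀ (by linarith)] at this
    linarith

lemma blockCorr_neg (hδ : 0 < δ) (hδT : δ < T) (h t : ℝ) :
    blockCorr T δ h (-t) = blockCorr T δ h t := by
  have hp := blockIncr_periodic hδ hδT h
  have hper : Function.Periodic (fun x => blockIncr T δ h (x + -t) * blockIncr T δ h x) T := by
    intro x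
    simp only [add_right_comm x T, hp _]
  rw [blockCorr, ← periodic_integral_comp_add hper t, blockCorr]
  refine intervalIntegral.integral_congr fun x _ => ?_
  simp [mul_comm]

lemma blockCorrDeriv_neg (hδ : 0 < δ) (hδT : δ < T) (h t : ℝ) :
    blockCorrDeriv T δ h (-t) = -blockCorrDeriv T δ h t := by
  have h1 := (hasDerivAt_blockCorr hδ hδT h (-t)).comp t (hasDerivAt_neg t)
  have h2 : blockCorr T δ h ∘ Neg.neg = blockCorr T δ h :=
    funext fun x => blockCorr_neg hδ hδT h x
  rw [h2] at h1
  linarith [h1.unique (hasDerivAt_blockCorr hδ hδT h t)]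

lemma blockCorrDeriv_periodic (hδ : 0 < δ) (hδT : δ < T) (h : ℝ) :
    Function.Periodic (blockCorrDeriv T δ h) T := by
  intro x
  have hp := blockIncrPrimitive_periodic hδ hδT h
  simp only [blockCorrDeriv, add_right_comm x T, hp _]

end Corr

lemma sum_range_eq_zero_of_odd_of_periodic {f : ℤ → ℝ} {N : ℕ} (hodd : ∀ m, f (-m) = -f m)
    (hper : ∀ m, f (m + N) = f m) (j : ℕ) : ∑ i ∈ Finset.range N, f (j - i) = 0 := by
  rcases N with _ | n
  · simp
  have step : ∀ k : ℕ, ∑ i ∈ Finset.range (n + 1), f ((k + 1 : ℕ) - i)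
      = ∑ i ∈ Finset.range (n + 1), f (k - i) := by
    intro k
    rw [Finset.sum_range_succ', Finset.sum_range_succ]
    congr 1
    · refine Finset.sum_congr rfl fun i _ => ?_
      congr 1
      push_cast
      ring
    · rw [← hper (k - n)]
      congr 1
      push_cast
      ring
  have all : ∀ k : ℕ, ∑ i ∈ Finset.range (n + 1), f (k - i)
      = ∑ i ∈ Finset.range (n + 1), f ((0 : ℕ) - i) := by
    intro k
    induction k with
    | zero => rfl
    | succ k ih => rw [step, ih]
  have h1 : ∑ i ∈ Finset.range (n + 1), f ((0 : ℕ) - i)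
      = -∑ i ∈ Finset.range (n + 1), f i := by
    rw [← Finset.sum_neg_distrib]
    exact Finset.sum_congr rfl fun i _ => by simp [hodd]
  have h2 : ∑ i ∈ Finset.range (n + 1), f (n - i) = ∑ i ∈ Finset.range (n + 1), f i := by
    rw [← Finset.sum_range_reflect (fun i : ℕ => f i)]
    refine Finset.sum_congr rfl fun i hi => ?_
    have := Finset.mem_range.1 hi
    congr 1
    push_cast [show n + 1 - 1 - i = n - i by omega, Nat.cast_sub (show i ≤ n by omega)]
    ring
  have h3 := all n
  rw [all j]
  linarith

section Train

variable {T δ : ℝ}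

/-- The sum of `N` copies of `block`, the `i`-th one starting at `b i`. -/
def train (T δ : ℝ) (N : ℕ) (b : ℕ → ℝ) (x : ℝ) : ℝ :=
  ∑ i ∈ Finset.range N, block T δ (x - b i)

lemma continuous_train (hδ : 0 < δ) (hδT : δ < T) (N : ℕ) (b : ℕ → ℝ) :
    Continuous (train T δ N b) := by
  have := continuous_block hδ hδT
  unfold train
  fun_prop

lemma train_periodic (hδ : 0 < δ) (hδT : δ < T) (N : ℕ) (b : ℕ → ℝ) :
    Function.Periodic (train T δ N b) T := by
  intro x
  simp only [train, add_sub_right_comm x T, block_periodic hδ hδT _]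

lemma abs_train_sub_le (hδ : 0 < δ) (hδT : δ < T) (N : ℕ) (b : ℕ → ℝ) (x y : ℝ) :
    |train T δ N b y - train T δ N b x| ≤ N * |y - x| := by
  rw [train, train, ← Finset.sum_sub_distrib]
  refine (Finset.abs_sum_le_sum_abs _ _).trans ?_
  refine (Finset.sum_le_sum fun i _ => abs_block_sub_le hδ hδT (x - b i) (y - b i)).trans ?_
  simp

lemma integral_train_incr_sq (hδ : 0 < δ) (hδT : δ < T) (N : ℕ) (b : ℕ → ℝ) (h : ℝ) :
    ∫ x in (0 : ℝ)..T, (train T δ N b (x + h) - train T δ N b x) ^ 2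
      = ∑ i ∈ Finset.range N, ∑ j ∈ Finset.range N, blockCorr T δ h (b i - b j) := by
  have hw := continuous_blockIncr hδ hδT h
  have hp := blockIncr_periodic hδ hδT h
  have e : ∀ x, (train T δ N b (x + h) - train T δ N b x) ^ 2
      = ∑ i ∈ Finset.range N, ∑ j ∈ Finset.range N,
        blockIncr T δ h (x - b j) * blockIncr T δ h (x - b i) := by
    intro x
    have : train T δ N b (x + h) - train T δ N b x
        = ∑ i ∈ Finset.range N, blockIncr T δ h (x - b i) := by
      rw [train, train, ← Finset.sum_sub_distrib]
      exact Finset.sum_congr rfl fun i _ => by rw [blockIncr, add_sub_right_comm]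
    rw [this, sq, Finset.sum_mul_sum, Finset.sum_comm]
  simp only [e]
  rw [intervalIntegral.integral_finsetSum
    fun i _ => Continuous.intervalIntegrable (by fun_prop) _ _]
  refine Finset.sum_congr rfl fun i _ => ?_
  rw [intervalIntegral.integral_finsetSum
    fun i _ => Continuous.intervalIntegrable (by fun_prop) _ _]
  refine Finset.sum_congr rfl fun j _ => ?_
  have hper : Function.Periodic
      (fun x => blockIncr T δ h (x - b j) * blockIncr T δ h (x - b i)) T := by
    intro x
    simp only [add_sub_right_comm x T, hp _]
  rw [← periodic_integral_comp_add hper (b i), blockCorr]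
  simp only [add_sub_assoc, sub_self, add_zero]

lemma equispaced_mem {d : ℝ} {N : ℕ} (hδd : δ ≤ d) (hd : 0 ≤ d) (hNd : N * d = T) {i j : ℕ}
    (hij : i < j) (hj : j < N) :
    ((j : ℝ) - i) * d ∈ Icc δ (T - δ) := by
  have h1 : (i : ℝ) + 1 ≤ j := by exact_mod_cast hij
  have h2 : (j : ℝ) + 1 ≤ N := by exact_mod_cast hj
  have h3 : (0 : ℝ) ≤ i := Nat.cast_nonneg i
  constructor <;> nlinarith

lemma blockCorr_pair_tangent_le (hδ : 0 < δ) (hδT : δ < T) {d : ℝ} {N : ℕ} (hδd : δ ≤ d)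
    (hNd : N * d = T) {b : ℕ → ℝ}
    (hb : ∀ i j, i < j → j < N → b j - b i ∈ Icc δ (T - δ)) (h : ℝ) {i j : ℕ} (hi : i < N)
    (hj : j < N) :
    blockCorr T δ h (((i : ℝ) - j) * d)
      + blockCorrDeriv T δ h (((i : ℝ) - j) * d) * ((b i - b j) - ((i : ℝ) - j) * d)
      ≤ blockCorr T δ h (b i - b j) := by
  rcases lt_trichotomy i j with hij | rfl | hij
  · have := blockCorr_tangent_le hδ hδT h (equispaced_mem hδd (by linarith) hNd hij hj)
      (hb i j hij hj)
    rw [← blockCorr_neg hδ hδT, ← blockCorr_neg hδ hδT h (b j - b i)] at this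
    rw [show ((i : ℝ) - j) * d = -(((j : ℝ) - i) * d) by ring, blockCorrDeriv_neg hδ hδT]
    rw [neg_sub] at this
    linarith
  · simp
  · exact blockCorr_tangent_le hδ hδT h (equispaced_mem hδd (by linarith) hNd hij hi)
      (hb j i hij hi)

lemma sum_tangent_eq_zero (hδ : 0 < δ) (hδT : δ < T) {d : ℝ} {N : ℕ}
    (hNd : N * d = T) (b : ℕ → ℝ) (h : ℝ) :
    ∑ i ∈ Finset.range N, ∑ j ∈ Finset.range N,
      blockCorrDeriv T δ h (((i : ℝ) - j) * d) * ((b i - b j) - ((i : ℝ) - j) * d) = 0 := by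
  set f : ℤ → ℝ := fun m => blockCorrDeriv T δ h (m * d) with hf
  have hodd : ∀ m, f (-m) = -f m := fun m => by
    simp only [hf, ← blockCorrDeriv_neg hδ hδT]
    push_cast
    ring_nf
  have hper : ∀ m, f (m + N) = f m := fun m => by
    simp only [hf]
    rw [← blockCorrDeriv_periodic hδ hδT h (m * d), ← hNd]
    push_cast
    ring_nf
  have hsum := sum_range_eq_zero_of_odd_of_periodic hodd hper
  set c : ℕ → ℝ := fun i => b i - i * d with hc
  have hterm : ∀ i j : ℕ,
      blockCorrDeriv T δ h (((i : ℝ) - j) * d) * ((b i - b j) - ((i : ℝ) - j) * d)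
        = f (i - j) * c i + f (j - i) * c j := by
    intro i j
    have : f (j - i) = -f (i - j) := by rw [← hodd, neg_sub]
    rw [this]
    simp only [hf, hc]
    push_cast
    ring
  simp only [hterm, Finset.sum_add_distrib]
  rw [Finset.sum_comm (f := fun i j : ℕ => f (j - i) * c j)]
  simp only [← Finset.sum_mul, hsum, zero_mul, Finset.sum_const_zero, add_zero]

/-- Equispaced trains minimise the mean square increment, for each step `h`. -/
lemma integral_train_incr_sq_ge (hδ : 0 < δ) (hδT : δ < T) {d : ℝ} {N : ℕ} (hδd : δ ≤ d)
    (hNd : N * d = T) {b : ℕ → ℝ}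
    (hb : ∀ i j, i < j → j < N → b j - b i ∈ Icc δ (T - δ)) (h : ℝ) :
    ∫ x in (0 : ℝ)..T, (train T δ N (fun i => i * d) (x + h) - train T δ N (fun i => i * d) x) ^ 2
      ≤ ∫ x in (0 : ℝ)..T, (train T δ N b (x + h) - train T δ N b x) ^ 2 := by
  rw [integral_train_incr_sq hδ hδT, integral_train_incr_sq hδ hδT]
  rw [← add_zero (∑ i ∈ Finset.range N, _), ← sum_tangent_eq_zero hδ hδT hNd b h,
    ← Finset.sum_add_distrib]
  refine Finset.sum_le_sum fun i hi => ?_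
  rw [← Finset.sum_add_distrib]
  refine Finset.sum_le_sum fun j hj => ?_
  rw [← sub_mul]
  exact blockCorr_pair_tangent_le hδ hδT hδd hNd hb h (Finset.mem_range.1 hi)
    (Finset.mem_range.1 hj)

lemma integral_train_incr_sq_gt (hδ : 0 < δ) (hδT : δ < T) {d : ℝ} {N : ℕ} (hδd : δ ≤ d)
    (hNd : N * d = T) {b : ℕ → ℝ}
    (hb : ∀ i j, i < j → j < N → b j - b i ∈ Icc δ (T - δ)) {h : ℝ} (hdh : |d - h| < δ)
    {k : ℕ} (hk : k + 1 < N) (hne : b (k + 1) - b k ≠ d) :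
    ∫ x in (0 : ℝ)..T, (train T δ N (fun i => i * d) (x + h) - train T δ N (fun i => i * d) x) ^ 2
      < ∫ x in (0 : ℝ)..T, (train T δ N b (x + h) - train T δ N b x) ^ 2 := by
  rw [integral_train_incr_sq hδ hδT, integral_train_incr_sq hδ hδT]
  rw [← add_zero (∑ i ∈ Finset.range N, _), ← sum_tangent_eq_zero hδ hδT hNd b h,
    ← Finset.sum_add_distrib]
  have hle : ∀ i ∈ Finset.range N, ∀ j ∈ Finset.range N,
      blockCorr T δ h ((i : ℝ) * d - j * d)
        + blockCorrDeriv T δ h (((i : ℝ) - j) * d) * ((b i - b j) - ((i : ℝ) - j) * d)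
        ≤ blockCorr T δ h (b i - b j) := fun i hi j hj => by
    rw [← sub_mul]
    exact blockCorr_pair_tangent_le hδ hδT hδd hNd hb h (Finset.mem_range.1 hi)
      (Finset.mem_range.1 hj)
  refine Finset.sum_lt_sum (fun i hi => ?_) ⟨k + 1, Finset.mem_range.2 hk, ?_⟩
  · rw [← Finset.sum_add_distrib]
    exact Finset.sum_le_sum (hle i hi)
  · rw [← Finset.sum_add_distrib]
    refine Finset.sum_lt_sum (hle _ (Finset.mem_range.2 hk))
      ⟨k, Finset.mem_range.2 (Nat.lt_of_succ_lt hk), ?_⟩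
    have hmem := equispaced_mem (δ := δ) hδd (by linarith) hNd (Nat.lt_succ_self k) hk
    have e : (((k + 1 : ℕ) : ℝ) - k) * d = d := by push_cast; ring
    rw [← sub_mul]
    rw [Nat.succ_eq_add_one, e] at hmem
    rw [e]
    exact blockCorr_tangent_lt hδ hδT hmem (hb k (k + 1) (Nat.lt_succ_self k) hk) hdh hne

end Train

section Energy

variable {s T K : ℝ} {u v : ℝ → ℝ}

lemma integrable_gagliardo_bound (hs : 0 < s) (hs1 : s < 1) (K C : ℝ) :
    Integrable fun h : ℝ => min ((K * |h|) ^ 2) (C ^ 2) / |h| ^ (1 + 2 * s) := by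
  set m : ℝ → ℝ := fun r => min ((K * r) ^ 2) (C ^ 2) / r ^ (1 + 2 * s) with hm
  have hmeas : Measurable m := by
    simp only [hm]
    fun_prop
  have hnn : ∀ r, 0 ≤ min ((K * r) ^ 2) (C ^ 2) := fun r => le_min (sq_nonneg _) (sq_nonneg _)
  have h1 : IntegrableOn m (Ioc 0 1) := by
    have hi : IntegrableOn (fun r : ℝ => K ^ 2 * r ^ (1 - 2 * s)) (Ioc 0 1) :=
      ((intervalIntegrable_iff_integrableOn_Ioc_of_le zero_le_one).1
        (intervalIntegral.intervalIntegrable_rpow' (by linarith))).const_mul _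
    refine hi.mono' hmeas.aestronglyMeasurable
      ((ae_restrict_mem measurableSet_Ioc).mono fun r hr => ?_)
    have hr0 : 0 < r := hr.1
    rw [Real.norm_of_nonneg (div_nonneg (hnn r) (Real.rpow_nonneg hr0.le _)),
      show (1 - 2 * s : ℝ) = 2 - (1 + 2 * s) by ring, Real.rpow_sub hr0, Real.rpow_two,
      ← mul_div_assoc, ← mul_pow]
    exact div_le_div_of_nonneg_right (min_le_left _ _) (Real.rpow_nonneg hr0.le _)
  have h2 : IntegrableOn m (Ioi 1) := by
    have hi : IntegrableOn (fun r : ℝ => C ^ 2 * r ^ (-(1 + 2 * s))) (Ioi 1) :=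
      (integrableOn_Ioi_rpow_of_lt (by linarith) one_pos).const_mul _
    refine hi.mono' hmeas.aestronglyMeasurable
      ((ae_restrict_mem measurableSet_Ioi).mono fun r hr => ?_)
    have hr0 : 0 < r := one_pos.trans hr
    rw [Real.norm_of_nonneg (div_nonneg (hnn r) (Real.rpow_nonneg hr0.le _)),
      Real.rpow_neg hr0.le, ← div_eq_mul_inv]
    exact div_le_div_of_nonneg_right (min_le_right _ _) (Real.rpow_nonneg hr0.le _)
  have h3 : IntegrableOn m (Ioi 0) := by
    rw [← Ioc_union_Ioi_eq_Ioi zero_le_one]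
    exact h1.union h2
  have h4 : IntegrableOn (fun h => m |h|) (Ioi 0) :=
    h3.congr_fun (fun r hr => by rw [abs_of_pos hr]) measurableSet_Ioi
  have h5 : IntegrableOn (fun h => m |h|) (Iic 0) := by
    rw [← Measure.map_neg_eq_self (volume : Measure ℝ)]
    have A : MeasurableEmbedding (Neg.neg : ℝ → ℝ) := (Homeomorph.neg ℝ).measurableEmbedding
    rw [A.integrableOn_map_iff]
    simp only [Function.comp_def, abs_neg, neg_preimage, neg_Iic, neg_zero]
    exact Iff.mpr integrableOn_Ici_iff_integrableOn_Ioi h4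
  have := h5.union h4
  rwa [Iic_union_Ioi, integrableOn_univ] at this

lemma integrable_gagliardo (hs : 0 < s) (hs1 : s < 1) (hT : 0 < T) (hu : Continuous u)
    (hper : Function.Periodic u T) (hlip : ∀ x y, |u y - u x| ≤ K * |y - x|) :
    Integrable (fun p : ℝ × ℝ => (u (p.1 + p.2) - u p.1) ^ 2 / |p.2| ^ (1 + 2 * s))
      ((volume.restrict (Ioo 0 T)).prod volume) := by
  have hK : 0 ≤ K := by simpa using (abs_nonneg _).trans (hlip 0 1)
  have hbd : ∀ x y, |u y - u x| ≤ K * T := by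
    intro x y
    obtain ⟨z, hz, hyz⟩ := hper.exists_mem_Ico hT y x
    rw [hyz]
    refine (hlip x z).trans (mul_le_mul_of_nonneg_left ?_ hK)
    rw [abs_of_nonneg (by linarith [hz.1])]
    linarith [hz.2]
  refine ((integrable_gagliardo_bound hs hs1 K (K * T)).comp_snd
    (volume.restrict (Ioo 0 T))).mono' ?_ (Eventually.of_forall fun p => ?_)
  · have := hu.measurable
    exact Measurable.aestronglyMeasurable (by fun_prop)
  · rw [Real.norm_of_nonneg (div_nonneg (sq_nonneg _) (Real.rpow_nonneg (abs_nonneg _) _))]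
    refine div_le_div_of_nonneg_right (le_min ?_ ?_) (Real.rpow_nonneg (abs_nonneg _) _)
    · refine sq_le_sq.2 ?_
      have := hlip p.1 (p.1 + p.2)
      rw [add_sub_cancel_left] at this
      rwa [abs_of_nonneg (mul_nonneg hK (abs_nonneg _))]
    · refine sq_le_sq.2 ?_
      rw [abs_of_nonneg (mul_nonneg hK hT.le)]
      exact hbd _ _

lemma Fs_eq_integral (hs : 0 < s) (hs1 : s < 1) (hT : 0 < T) (hu : Continuous u)
    (hper : Function.Periodic u T) (hlip : ∀ x y, |u y - u x| ≤ K * |y - x|) :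
    Integrable (fun h => (∫ x in (0 : ℝ)..T, (u (x + h) - u x) ^ 2) / |h| ^ (1 + 2 * s)) ∧
    Fs s T u = (1 / (2 * T)) *
      ∫ h, (∫ x in (0 : ℝ)..T, (u (x + h) - u x) ^ 2) / |h| ^ (1 + 2 * s) := by
  have hint := integrable_gagliardo hs hs1 hT hu hper hlip
  have e : ∀ h : ℝ, (∫ x in (0 : ℝ)..T, (u (x + h) - u x) ^ 2) / |h| ^ (1 + 2 * s)
      = ∫ x in Ioo 0 T, (u (x + h) - u x) ^ 2 / |h| ^ (1 + 2 * s) := fun h => by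
    rw [integral_div, intervalIntegral.integral_of_le hT.le, integral_Ioc_eq_integral_Ioo]
  simp only [e]
  refine ⟨hint.integral_prod_right, ?_⟩
  rw [Fs, ← integral_integral_swap (f := fun x h => (u (x + h) - u x) ^ 2 / |h| ^ (1 + 2 * s)) hint]
  congr 1
  refine integral_congr_ae (Eventually.of_forall fun x => ?_)
  simp only
  rw [← integral_add_left_eq_self _ x]
  refine integral_congr_ae (Eventually.of_forall fun h => ?_)
  simp only [sub_add_cancel_left, abs_neg]
  rw [← neg_sub, neg_sq]

lemma Fs_mono (hs : 0 < s) (hs1 : s < 1) (hT : 0 < T)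
    (hu : Continuous u) (hup : Function.Periodic u T) (hul : ∀ x y, |u y - u x| ≤ K * |y - x|)
    (hv : Continuous v) (hvp : Function.Periodic v T) (hvl : ∀ x y, |v y - v x| ≤ K * |y - x|)
    (hle : ∀ h, ∫ x in (0 : ℝ)..T, (u (x + h) - u x) ^ 2
      ≤ ∫ x in (0 : ℝ)..T, (v (x + h) - v x) ^ 2) :
    Fs s T u ≤ Fs s T v := by
  obtain ⟨iu, eu⟩ := Fs_eq_integral hs hs1 hT hu hup hul
  obtain ⟨iv, ev⟩ := Fs_eq_integral hs hs1 hT hv hvp hvl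
  rw [eu, ev]
  refine mul_le_mul_of_nonneg_left (integral_mono iu iv fun h => ?_) (by positivity)
  exact div_le_div_of_nonneg_right (hle h) (Real.rpow_nonneg (abs_nonneg _) _)

lemma Fs_strictMono (hs : 0 < s) (hs1 : s < 1) (hT : 0 < T)
    (hu : Continuous u) (hup : Function.Periodic u T) (hul : ∀ x y, |u y - u x| ≤ K * |y - x|)
    (hv : Continuous v) (hvp : Function.Periodic v T) (hvl : ∀ x y, |v y - v x| ≤ K * |y - x|)
    (hle : ∀ h, ∫ x in (0 : ℝ)..T, (u (x + h) - u x) ^ 2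
      ≤ ∫ x in (0 : ℝ)..T, (v (x + h) - v x) ^ 2) {a b : ℝ} (ha : 0 ≤ a) (hab : a < b)
    (hlt : ∀ h ∈ Ioo a b, ∫ x in (0 : ℝ)..T, (u (x + h) - u x) ^ 2
      < ∫ x in (0 : ℝ)..T, (v (x + h) - v x) ^ 2) :
    Fs s T u < Fs s T v := by
  obtain ⟨iu, eu⟩ := Fs_eq_integral hs hs1 hT hu hup hul
  obtain ⟨iv, ev⟩ := Fs_eq_integral hs hs1 hT hv hvp hvl
  rw [eu, ev]
  refine mul_lt_mul_of_pos_left ?_ (by positivity)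
  rw [← sub_pos, ← integral_sub iv iu]
  refine (integral_pos_iff_support_of_nonneg (fun h => ?_) (iv.sub iu)).2 ?_
  · exact sub_nonneg.2 (div_le_div_of_nonneg_right (hle h) (Real.rpow_nonneg (abs_nonneg _) _))
  · refine lt_of_lt_of_le ?_ (measure_mono (s := Ioo a b) fun h hh => ?_)
    · rw [Real.volume_Ioo]
      exact ENNReal.ofReal_pos.2 (sub_pos.2 hab)
    · exact (sub_pos.2 (div_lt_div_of_pos_right (hlt h hh) (Real.rpow_pos_of_pos
        (abs_pos.2 (ha.trans_lt hh.1).ne') _))).ne'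

end Energy

section Ubar

variable {T Λ δ : ℝ}

lemma block_sub_of_nonpos (hδ : 0 < δ) (hδT : δ < T) {x y : ℝ} (hx : δ - T ≤ x) (hxy : x ≤ y)
    (hy : y ≤ 0) : block T δ y - block T δ x = -(δ / T) * (y - x) := by
  rw [← block_periodic hδ hδT y, ← block_periodic hδ hδT x,
    block_sub_of_le_right hδ hδT (by linarith) (by linarith) (by linarith)]
  ring

lemma train_equispaced_periodic (hδ : 0 < δ) (hδT : δ < T) {d : ℝ} {N : ℕ} (hNd : N * d = T) :
    Function.Periodic (train T δ N fun i => i * d) d := by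
  intro x
  rcases N with _ | n
  · simp [train]
  rw [train, train, Finset.sum_range_succ', Finset.sum_range_succ]
  congr 1
  · refine Finset.sum_congr rfl fun i _ => ?_
    congr 1
    push_cast
    ring
  · rw [← block_periodic hδ hδT (x - n * d), ← hNd]
    congr 1
    push_cast
    ring

lemma train_equispaced_sub (hδ : 0 < δ) (hδT : δ < T) {d : ℝ} {N : ℕ} (hN : 0 < N) (hδd : δ ≤ d)
    (hNd : N * d = T) {y : ℝ} (hy : y ∈ Icc 0 d) :
    train T δ N (fun i => i * d) y - train T δ N (fun i => i * d) 0
      = block T δ y - (N - 1) * ((δ / T) * y) := by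
  obtain ⟨n, rfl⟩ : ∃ n, N = n + 1 := ⟨N - 1, by omega⟩
  push_cast at hNd
  rw [train, train, ← Finset.sum_sub_distrib, Finset.sum_range_succ']
  have : ∀ i ∈ Finset.range n, block T δ (y - (i + 1 : ℕ) * d) - block T δ (0 - (i + 1 : ℕ) * d)
      = -((δ / T) * y) := by
    intro i hi
    have h1 : (i : ℝ) + 1 ≤ n := by exact_mod_cast Finset.mem_range.1 hi
    have h2 : (0 : ℝ) ≤ i := Nat.cast_nonneg i
    have h3 : 0 < d := hδ.trans_le hδd
    rw [block_sub_of_nonpos hδ hδT]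
    · ring
    · push_cast; nlinarith
    · linarith [hy.1]
    · push_cast; nlinarith [hy.2]
  rw [Finset.sum_congr rfl this]
  simp [block_zero]
  ring

lemma ubar_eq (hΛ : 0 < Λ) (hδ : 0 < δ) (k : ℤ) {y : ℝ}
    (hy : y ∈ Ico (k * ((Λ + 1) * δ) - δ) (k * ((Λ + 1) * δ) - δ + (Λ + 1) * δ)) :
    ubar Λ δ y = if y - k * ((Λ + 1) * δ) < 0 then -Λ * (y - k * ((Λ + 1) * δ))
      else y - k * ((Λ + 1) * δ) := by
  have hd : 0 < (Λ + 1) * δ := by positivity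
  have hfl : ⌊(y + δ) / ((Λ + 1) * δ)⌋ = k := by
    rw [Int.floor_eq_iff, le_div_iff₀ hd, div_lt_iff₀ hd]
    constructor <;> linarith [hy.1, hy.2]
  have hz : (Λ + 1) * δ * Int.fract ((y + δ) / ((Λ + 1) * δ)) - δ = y - k * ((Λ + 1) * δ) := by
    rw [Int.fract, hfl]
    field_simp
    ring
  simp only [ubar, hz]

lemma ubar_periodic (hΛ : 0 < Λ) (hδ : 0 < δ) : Function.Periodic (ubar Λ δ) ((Λ + 1) * δ) := by
  intro x
  have : (x + (Λ + 1) * δ + δ) / ((Λ + 1) * δ) = (x + δ) / ((Λ + 1) * δ) + 1 := by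
    field_simp
    ring
  simp only [ubar, this, Int.fract_add_one]

/-- `ubar` is, up to an affine change of the values, an equispaced train of blocks. -/
lemma ubar_eq_train (hΛ : 0 < Λ) (hδ : 0 < δ) (hδT : δ < T) {L : ℕ} (hL : 0 < L)
    (hT : L * ((Λ + 1) * δ) = T) :
    ∃ c : ℝ, ∀ x, ubar Λ δ x
      = c - (Λ + 1) * train T δ L (fun i => i * ((Λ + 1) * δ)) (x + δ) := by
  have hd : 0 < (Λ + 1) * δ := by positivity
  have hδd : δ ≤ (Λ + 1) * δ := by nlinarith
  have hT0 : 0 < T := hδ.trans hδT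
  have hdT : (Λ + 1) * δ ≤ T := by
    have : (1 : ℝ) ≤ L := by exact_mod_cast hL
    nlinarith
  have hNδ : L * ((Λ + 1) * (δ / T)) = 1 := by
    field_simp
    linarith
  set F := train T δ L (fun i => i * ((Λ + 1) * δ)) with hF
  refine ⟨Λ * δ + (Λ + 1) * F 0, fun x => ?_⟩
  have hper : Function.Periodic
      (fun y => ubar Λ δ (y - δ) + (Λ + 1) * F y) ((Λ + 1) * δ) := by
    intro y
    simp only [add_sub_right_comm, ubar_periodic hΛ hδ _, hF,
      train_equispaced_periodic hδ hδT hT y]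
  suffices h : ∀ y, ubar Λ δ (y - δ) + (Λ + 1) * F y = Λ * δ + (Λ + 1) * F 0 by
    have := h (x + δ)
    rw [add_sub_cancel_right] at this
    linarith
  intro y
  obtain ⟨z, hz, hyz⟩ := hper.exists_mem_Ico₀ hd y
  rw [hyz]
  have h1 := train_equispaced_sub hδ hδT hL hδd hT (Ico_subset_Icc_self hz)
  rw [← hF] at h1
  have h2 := ubar_eq hΛ hδ 0 (y := z - δ) (by
    simp only [Int.cast_zero, zero_mul, zero_sub]
    constructor <;> linarith [hz.1, hz.2])
  simp only [Int.cast_zero, zero_mul, sub_zero] at h2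
  have hb : block T δ z = if z - δ < 0 then (1 - δ / T) * z else δ - (δ / T) * z := by
    split_ifs with h
    · simpa [block_zero] using block_sub_of_le_left hδ hδT le_rfl hz.1 (by linarith)
    · have e1 := block_sub_of_le_left hδ hδT le_rfl hδ.le le_rfl
      have e2 := block_sub_of_le_right hδ hδT le_rfl (not_lt.1 (by linarith : ¬ z < δ))
        (by linarith [hz.2])
      rw [block_zero] at e1
      linear_combination e1 + e2
  rw [hb] at h1
  rw [h2]
  split_ifs at h1 ⊢ with h
  · linear_combination (Λ + 1) * h1 - z * hNδ
  · linear_combination (Λ + 1) * h1 - z * hNδ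

lemma continuous_ubar (hΛ : 0 < Λ) (hδ : 0 < δ) : Continuous (ubar Λ δ) := by
  have hδd : δ < (Λ + 1) * δ := by nlinarith
  obtain ⟨c, hc⟩ := ubar_eq_train hΛ hδ hδd one_pos (by simp)
  have := continuous_train hδ hδd 1 (fun i => i * ((Λ + 1) * δ))
  rw [funext hc]
  fun_prop

/-- The corner points of `ubar`. -/
def ubarCorners (Λ δ : ℝ) : Set ℝ :=
  {x | ∃ k : ℤ, x = k * ((Λ + 1) * δ) - δ ∨ x = k * ((Λ + 1) * δ)}

lemma countable_ubarCorners : (ubarCorners Λ δ).Countable := by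
  have : ubarCorners Λ δ = ⋃ k : ℤ, {k * ((Λ + 1) * δ) - δ, k * ((Λ + 1) * δ)} := by
    ext x
    simp [ubarCorners]
  rw [this]
  exact countable_iUnion fun k => (Set.toFinite _).countable

lemma isClosed_ubarCorners (hΛ : 0 < Λ) (hδ : 0 < δ) : IsClosed (ubarCorners Λ δ) := by
  have hd : (Λ + 1) * δ ≠ 0 := by positivity
  have hZ : IsClosed (range ((↑) : ℤ → ℝ)) := Int.isClosedEmbedding_coe_real.isClosed_range
  have : ubarCorners Λ δ = (fun x => (x + δ) / ((Λ + 1) * δ)) ⁻¹' range ((↑) : ℤ → ℝ)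
      ∪ (fun x => x / ((Λ + 1) * δ)) ⁻¹' range ((↑) : ℤ → ℝ) := by
    ext x
    simp only [ubarCorners, mem_ofPred_eq, exists_or, mem_union, mem_preimage, mem_range,
      eq_div_iff hd, eq_sub_iff_add_eq, eq_comm]
  rw [this]
  exact (hZ.preimage (by fun_prop)).union (hZ.preimage (by fun_prop))

lemma ubarCorners_isolated (hΛ : 0 < Λ) (hδ : 0 < δ) {x : ℝ} (hx : x ∈ ubarCorners Λ δ) :
    ∃ ε > 0, ubarCorners Λ δ ∩ Ioo (x - ε) (x + ε) ⊆ {x} := by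
  refine ⟨min δ (Λ * δ), lt_min hδ (mul_pos hΛ hδ), ?_⟩
  rintro y ⟨⟨j, hj⟩, hy⟩
  obtain ⟨k, hk⟩ := hx
  rw [mem_singleton_iff]
  have e1 : min δ (Λ * δ) ≤ δ := min_le_left _ _
  have e2 : min δ (Λ * δ) ≤ Λ * δ := min_le_right _ _
  have hΛδ : 0 < Λ * δ := mul_pos hΛ hδ
  have hy1 := hy.1
  have hy2 := hy.2
  rcases lt_trichotomy j k with hjk | rfl | hjk
  · have : (j : ℝ) + 1 ≤ k := by exact_mod_cast hjk
    have : ((j : ℝ) + 1) * ((Λ + 1) * δ) ≤ k * ((Λ + 1) * δ) :=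
      mul_le_mul_of_nonneg_right this (by positivity)
    exfalso
    rcases hj with hj | hj <;> rcases hk with hk | hk <;> nlinarith
  · rcases hj with hj | hj <;> rcases hk with hk | hk <;> linarith
  · have : (k : ℝ) + 1 ≤ j := by exact_mod_cast hjk
    have : ((k : ℝ) + 1) * ((Λ + 1) * δ) ≤ j * ((Λ + 1) * δ) :=
      mul_le_mul_of_nonneg_right this (by positivity)
    exfalso
    rcases hj with hj | hj <;> rcases hk with hk | hk <;> nlinarith

lemma exists_int_mem_Ico (hΛ : 0 < Λ) (hδ : 0 < δ) (x : ℝ) : ∃ k : ℤ,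
    x ∈ Ico (k * ((Λ + 1) * δ) - δ) (k * ((Λ + 1) * δ) - δ + (Λ + 1) * δ) := by
  have hd : 0 < (Λ + 1) * δ := by positivity
  have h := (Int.floor_eq_iff (a := (x + δ) / ((Λ + 1) * δ))).1 rfl
  rw [le_div_iff₀ hd, div_lt_iff₀ hd] at h
  exact ⟨⌊(x + δ) / ((Λ + 1) * δ)⌋, by linarith [h.1], by linarith [h.2]⟩

lemma ubar_eqOn_neg (hΛ : 0 < Λ) (hδ : 0 < δ) (k : ℤ) {y : ℝ}
    (hy : y ∈ Ioo (k * ((Λ + 1) * δ) - δ) (k * ((Λ + 1) * δ))) :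
    ubar Λ δ y = -Λ * y + Λ * (k * ((Λ + 1) * δ)) := by
  rw [ubar_eq hΛ hδ k ⟨hy.1.le, by nlinarith [hy.2]⟩, if_pos (by linarith [hy.2])]
  ring

lemma ubar_eqOn_pos (hΛ : 0 < Λ) (hδ : 0 < δ) (k : ℤ) {y : ℝ}
    (hy : y ∈ Ioo (k * ((Λ + 1) * δ)) (k * ((Λ + 1) * δ) - δ + (Λ + 1) * δ)) :
    ubar Λ δ y = 1 * y + -(k * ((Λ + 1) * δ)) := by
  rw [ubar_eq hΛ hδ k ⟨by linarith [hy.1], hy.2⟩, if_neg (by linarith [hy.1])]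
  ring

lemma hasDerivAt_of_eqOn_Ioo {f : ℝ → ℝ} {a b m q x : ℝ} (hx : x ∈ Ioo a b)
    (h : ∀ y ∈ Ioo a b, f y = m * y + q) : HasDerivAt f m x := by
  have : HasDerivAt (fun y => m * y + q) m x := by
    simpa using ((hasDerivAt_id x).const_mul m).add_const q
  exact this.congr_of_eventuallyEq (Filter.eventually_of_mem (Ioo_mem_nhds hx.1 hx.2) h)

lemma exists_affine_of_eqOn_Ioo {f : ℝ → ℝ} {a b m q x : ℝ} (hx : x ∈ Ioo a b)
    (h : ∀ y ∈ Ioo a b, f y = m * y + q) :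
    ∃ ε > 0, ∃ m q : ℝ, ∀ y : ℝ, |y - x| < ε → f y = m * y + q := by
  refine ⟨min (x - a) (b - x), lt_min (sub_pos.2 hx.1) (sub_pos.2 hx.2), m, q, fun y hy => ?_⟩
  have h1 := hy.trans_le (min_le_left _ _)
  have h2 := hy.trans_le (min_le_right _ _)
  rw [abs_lt] at h1 h2
  exact h y ⟨by linarith [h1.1], by linarith [h2.2]⟩

lemma mem_Ioo_of_notMem_ubarCorners (hΛ : 0 < Λ) (hδ : 0 < δ) {x : ℝ}
    (hx : x ∉ ubarCorners Λ δ) : ∃ k : ℤ,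
    x ∈ Ioo (k * ((Λ + 1) * δ) - δ) (k * ((Λ + 1) * δ)) ∨
    x ∈ Ioo (k * ((Λ + 1) * δ)) (k * ((Λ + 1) * δ) - δ + (Λ + 1) * δ) := by
  obtain ⟨k, hk⟩ := exists_int_mem_Ico hΛ hδ x
  refine ⟨k, ?_⟩
  have h1 : x ≠ k * ((Λ + 1) * δ) - δ := fun h => hx ⟨k, Or.inl h⟩
  have h2 : x ≠ k * ((Λ + 1) * δ) := fun h => hx ⟨k, Or.inr h⟩
  rcases h2.lt_or_gt with h | h
  · exact Or.inl ⟨hk.1.lt_of_ne h1.symm, h⟩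
  · exact Or.inr ⟨h, hk.2⟩

lemma admissible_ubar (hΛ : 0 < Λ) (hδ : 0 < δ) {L : ℕ} (hT : L * ((Λ + 1) * δ) = T) :
    Admissible T Λ δ (ubar Λ δ) where
  cont := continuous_ubar hΛ hδ
  per := hT ▸ (ubar_periodic hΛ hδ).nat_mul L
  pwAffine := by
    refine ⟨ubarCorners Λ δ, isClosed_ubarCorners hΛ hδ,
      fun x hx => ubarCorners_isolated hΛ hδ hx, fun x hx => ?_⟩
    obtain ⟨k, hk | hk⟩ := mem_Ioo_of_notMem_ubarCorners hΛ hδ hx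
    · exact exists_affine_of_eqOn_Ioo hk fun y hy => ubar_eqOn_neg hΛ hδ k hy
    · exact exists_affine_of_eqOn_Ioo hk fun y hy => ubar_eqOn_pos hΛ hδ k hy
  slopes := by
    filter_upwards [countable_ubarCorners.ae_notMem volume] with x hx
    obtain ⟨k, hk | hk⟩ := mem_Ioo_of_notMem_ubarCorners hΛ hδ hx
    · exact Or.inr (hasDerivAt_of_eqOn_Ioo hk fun y hy => ubar_eqOn_neg hΛ hδ k hy)
    · exact Or.inl (hasDerivAt_of_eqOn_Ioo hk fun y hy => ubar_eqOn_pos hΛ hδ k hy)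
  negRegion := by
    have hΛδ : 0 < Λ * δ := mul_pos hΛ hδ
    refine ⟨fun n => (Equiv.intEquivNat.symm n : ℤ) * ((Λ + 1) * δ) - δ, fun n x hx => ?_,
      fun x hx => ?_, fun i j hij => ?_⟩
    · rw [sub_add_cancel] at hx
      exact hasDerivAt_of_eqOn_Ioo hx fun y hy => ubar_eqOn_neg hΛ hδ _ hy
    · obtain ⟨k, hk⟩ := exists_int_mem_Ico hΛ hδ x
      refine mem_iUnion.2 ⟨Equiv.intEquivNat k, ?_⟩
      beta_reduce
      rw [Equiv.symm_apply_apply, sub_add_cancel]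
      refine ⟨hk.1, not_lt.1 fun hlt => ?_⟩
      have h1 : HasDerivAt (ubar Λ δ) 1 x :=
        hasDerivAt_of_eqOn_Ioo ⟨hlt, hk.2⟩ fun y hy => ubar_eqOn_pos hΛ hδ k hy
      linarith [h1.unique hx]
    · have hne : Equiv.intEquivNat.symm i ≠ Equiv.intEquivNat.symm j := by simpa using hij
      rintro x ⟨⟨h1, h2⟩, h3, h4⟩
      exfalso
      rcases hne.lt_or_gt with h | h
      · have : ((Equiv.intEquivNat.symm i : ℤ) : ℝ) + 1 ≤ (Equiv.intEquivNat.symm j : ℤ) := by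
          exact_mod_cast h
        have := mul_le_mul_of_nonneg_right this (show 0 ≤ (Λ + 1) * δ by positivity)
        linarith
      · have : ((Equiv.intEquivNat.symm j : ℤ) : ℝ) + 1 ≤ (Equiv.intEquivNat.symm i : ℤ) := by
          exact_mod_cast h
        have := mul_le_mul_of_nonneg_right this (show 0 ≤ (Λ + 1) * δ by positivity)
        linarith

end Ubar

section Structure

variable {T Λ δ : ℝ} {u : ℝ → ℝ}

lemma PiecewiseAffine.exists_countable (hu : PiecewiseAffine u) :
    ∃ S : Set ℝ, S.Countable ∧ ∀ x ∉ S, DifferentiableAt ℝ u x := by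
  obtain ⟨S, -, hiso, haff⟩ := hu
  refine ⟨S, ?_, fun x hx => ?_⟩
  · refine IsLindelof.countable (HereditarilyLindelofSpace.isLindelof S) ?_
    refine discreteTopology_subtype_iff'.2 fun x hx => ?_
    obtain ⟨ε, hε, hS⟩ := hiso x hx
    refine ⟨Ioo (x - ε) (x + ε), isOpen_Ioo, ?_⟩
    rw [inter_comm]
    exact hS.antisymm (singleton_subset_iff.2 ⟨hx, by linarith, by linarith⟩)
  · obtain ⟨ε, hε, m, q, h⟩ := haff x hx
    refine (hasDerivAt_of_eqOn_Ioo (a := x - ε) (b := x + ε) ⟨by linarith, by linarith⟩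
      fun y hy => h y ?_).differentiableAt
    rw [abs_lt]
    constructor <;> linarith [hy.1, hy.2]

lemma Admissible.intervalIntegrable_deriv (hu : Admissible T Λ δ u) (x y : ℝ) :
    IntervalIntegrable (deriv u) volume x y := by
  refine (intervalIntegrable_const (c := 1 + |Λ|)).mono_fun
    (measurable_deriv u).aestronglyMeasurable (ae_restrict_of_ae ?_)
  filter_upwards [hu.slopes] with z hz
  rw [Real.norm_eq_abs, Real.norm_eq_abs, abs_of_nonneg (by positivity : 0 ≤ 1 + |Λ|)]
  rcases hz with hz | hz <;> rw [hz.deriv]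
  · rw [abs_one]
    linarith [abs_nonneg Λ]
  · rw [abs_neg]
    linarith

lemma Admissible.integral_deriv (hu : Admissible T Λ δ u) (x y : ℝ) :
    ∫ z in x..y, deriv u z = u y - u x := by
  obtain ⟨S, hS, hd⟩ := hu.pwAffine.exists_countable
  exact integral_eq_of_hasDerivAt_off_countable u (deriv u) hS hu.cont.continuousOn
    (fun z hz => (hd z hz.2).hasDerivAt) (hu.intervalIntegrable_deriv x y)

lemma Admissible.exists_not_hasDerivAt (hu : Admissible T Λ δ u) (hT : 0 < T) (hΛ : 0 < Λ) :
    ∃ p, ¬ HasDerivAt u (-Λ) p := by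
  by_contra! h
  have h1 := hu.integral_deriv 0 T
  have h2 := hu.per 0
  rw [zero_add] at h2
  rw [h2, sub_self, intervalIntegral.integral_congr fun z _ => (h z).deriv] at h1
  simp only [intervalIntegral.integral_const, smul_eq_mul, sub_zero] at h1
  nlinarith

lemma finite_inter_Icc_of_separated (hδ : 0 < δ) {A : Set ℝ}
    (hA : ∀ x ∈ A, ∀ y ∈ A, x < y → x + δ ≤ y) (p q : ℝ) : (A ∩ Icc p q).Finite := by
  refine Set.Finite.of_injOn (f := fun x => ⌊x / δ⌋) (t := Icc ⌊p / δ⌋ ⌊q / δ⌋)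
    (fun x hx => ?_) (fun x hx y hy hxy => ?_) (Set.finite_Icc _ _)
  · exact ⟨Int.floor_mono (div_le_div_of_nonneg_right hx.2.1 hδ.le),
      Int.floor_mono (div_le_div_of_nonneg_right hx.2.2 hδ.le)⟩
  · have h := Int.abs_sub_lt_one_of_floor_eq_floor hxy
    rw [← sub_div, abs_div, abs_of_pos hδ, div_lt_one hδ, abs_lt] at h
    by_contra hne
    rcases lt_or_gt_of_ne hne with hlt | hlt
    · linarith [hA x hx.1 y hy.1 hlt]
    · linarith [hA y hy.1 x hx.1 hlt]

lemma exists_sorted_enumeration {B : Finset ℝ} {p q : ℝ} (hB : ∀ x ∈ B, x ∈ Icc p q)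
    (hsep : ∀ x ∈ B, ∀ y ∈ B, x < y → x + δ ≤ y) : ∃ b : ℕ → ℝ,
    (∀ i j, i < j → j < B.card → b j - b i ∈ Icc δ (q - p)) ∧
    ∀ g : ℝ → ℝ, ∑ i ∈ Finset.range B.card, g (b i) = ∑ x ∈ B, g x := by
  classical
  let e := B.orderIsoOfFin rfl
  refine ⟨fun i => if h : i < B.card then e ⟨i, h⟩ else 0, fun i j hij hj => ?_, fun g => ?_⟩
  · simp only [hj, hij.trans hj, dif_pos]
    have hlt : e ⟨i, hij.trans hj⟩ < e ⟨j, hj⟩ := e.lt_iff_lt.2 hij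
    have h1 := hsep _ (e ⟨i, hij.trans hj⟩).2 _ (e ⟨j, hj⟩).2 hlt
    have h2 := hB _ (e ⟨i, hij.trans hj⟩).2
    have h3 := hB _ (e ⟨j, hj⟩).2
    exact ⟨by linarith, by linarith [h2.1, h3.2]⟩
  · rw [Finset.sum_range, ← Finset.sum_coe_sort B]
    refine Fintype.sum_equiv e.toEquiv _ _ fun i => ?_
    simp

lemma blockSlope_sub_eq_ite (hδ : 0 < δ) (hδT : δ < T) {p x z : ℝ} (hx : x ∈ Icc p (p + T - δ))
    (hz : z ∈ Ioo p (p + T)) (hne : z ≠ x) [Decidable (z ∈ Ioo x (x + δ))] :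
    blockSlope T δ (z - x) = (if z ∈ Ioo x (x + δ) then 1 else 0) - δ / T := by
  split_ifs with h
  · exact blockSlope_of_mem_Ico_left hδT ⟨by linarith [h.1], by linarith [h.2]⟩
  · rw [zero_sub]
    rcases hne.lt_or_gt with hlt | hgt
    · exact blockSlope_of_mem_Ico_neg hδ hδT ⟨by linarith [hz.1, hx.2], by linarith⟩
    · have : ¬ z < x + δ := fun h' => h ⟨hgt, h'⟩
      exact blockSlope_of_mem_Ico_right hδ ⟨by linarith, by linarith [hz.2, hx.1]⟩

/-- Almost everywhere on one period, the derivative of an admissible function is given by the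
intervals of length `δ` contained in that period. -/
lemma Admissible.exists_deriv_eq (hu : Admissible T Λ δ u) (hΛ : 0 < Λ) (hδ : 0 < δ)
    (hδT : δ < T) : ∃ (p : ℝ) (B : Finset ℝ), (∀ x ∈ B, x ∈ Icc p (p + T - δ)) ∧
      (∀ x ∈ B, ∀ y ∈ B, x < y → x + δ ≤ y) ∧
      ∀ᵐ z : ℝ, z ∈ Ioo p (p + T) → deriv u z
        = 1 - (Λ + 1) * B.card * (δ / T) - (Λ + 1) * ∑ x ∈ B, blockSlope T δ (z - x) := by
  classical
  obtain ⟨a, hneg, hcov, hdisj⟩ := hu.negRegion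
  obtain ⟨p, hp⟩ := hu.exists_not_hasDerivAt (hδ.trans hδT) hΛ
  have hpT : ¬ HasDerivAt u (-Λ) (p + T) := fun h => hp <| by
    simpa only [hu.per _] using h.comp_add_const p T
  have hsep : ∀ x ∈ range a, ∀ y ∈ range a, x < y → x + δ ≤ y := by
    rintro _ ⟨i, rfl⟩ _ ⟨j, rfl⟩ hij
    by_contra! hlt
    have hne : i ≠ j := fun h => hij.ne (congrArg a h)
    have := hdisj hne (x := a j) ⟨⟨hij.le, hlt.le⟩, le_rfl, by linarith⟩ (y := a i + δ)
      ⟨⟨by linarith, le_rfl⟩, hlt.le, by linarith⟩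
    linarith
  have hfin := finite_inter_Icc_of_separated hδ hsep p (p + T - δ)
  refine ⟨p, hfin.toFinset, fun x hx => (hfin.mem_toFinset.1 hx).2,
    fun x hx y hy => hsep x (hfin.mem_toFinset.1 hx).1 y (hfin.mem_toFinset.1 hy).1, ?_⟩
  filter_upwards [hu.slopes, (countable_range a).ae_notMem volume,
    (countable_range fun k => a k + δ).ae_notMem volume] with z hz hz1 hz2 hzp
  have hterm : ∀ x ∈ hfin.toFinset, blockSlope T δ (z - x)
      = (if z ∈ Ioo x (x + δ) then 1 else 0) - δ / T := by
    intro x hx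
    obtain ⟨⟨k, rfl⟩, hxp⟩ := hfin.mem_toFinset.1 hx
    exact blockSlope_sub_eq_ite hδ hδT hxp hzp fun h => hz1 ⟨k, h.symm⟩
  rw [Finset.sum_congr rfl hterm, Finset.sum_sub_distrib, Finset.sum_const, nsmul_eq_mul]
  suffices h : deriv u z = 1 - (Λ + 1) * ∑ x ∈ hfin.toFinset,
      (if z ∈ Ioo x (x + δ) then (1 : ℝ) else 0) by
    rw [h]
    ring
  rcases hz with hz | hz
  · rw [hz.deriv, Finset.sum_eq_zero, mul_zero, sub_zero]
    intro x hx
    obtain ⟨⟨k, rfl⟩, -⟩ := hfin.mem_toFinset.1 hx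
    refine if_neg fun h => ?_
    linarith [hz.unique (hneg k h)]
  · obtain ⟨k, hk⟩ := mem_iUnion.1 (hcov hz)
    have hk' : z ∈ Ioo (a k) (a k + δ) :=
      ⟨hk.1.lt_of_ne fun h => hz1 ⟨k, h⟩, hk.2.lt_of_ne fun h => hz2 ⟨k, h.symm⟩⟩
    have hak : a k ∈ hfin.toFinset := by
      refine hfin.mem_toFinset.2 ⟨⟨k, rfl⟩, not_lt.1 fun h => ?_, not_lt.1 fun h => ?_⟩
      · exact hp (hneg k ⟨h, hzp.1.trans hk'.2⟩)
      · exact hpT (hneg k ⟨hk'.1.trans hzp.2, by linarith⟩)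
    rw [hz.deriv, Finset.sum_eq_single (a k), if_pos hk']
    · ring
    · intro x hx hne
      refine if_neg fun h => ?_
      have hxA := (hfin.mem_toFinset.1 hx).1
      rcases hne.lt_or_gt with hlt | hlt
      · linarith [hsep x hxA _ ⟨k, rfl⟩ hlt, h.2, hk'.1]
      · linarith [hsep _ ⟨k, rfl⟩ x hxA hlt, h.1, hk'.2]
    · exact fun h => absurd hak h

/-- Every admissible function is, up to an affine change of the values, a train of blocks. -/
lemma Admissible.exists_train (hu : Admissible T Λ δ u) (hΛ : 0 < Λ) (hδ : 0 < δ)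
    (hδT : δ < T) {L : ℕ} (hT : L * ((Λ + 1) * δ) = T) : ∃ (c : ℝ) (b : ℕ → ℝ),
      (∀ i j, i < j → j < L → b j - b i ∈ Icc δ (T - δ)) ∧
      ∀ x, u x = c - (Λ + 1) * train T δ L b x := by
  have hT0 : 0 < T := hδ.trans hδT
  obtain ⟨p, B, hBp, hsep, hderiv⟩ := hu.exists_deriv_eq hΛ hδ hδT
  set κ := 1 - (Λ + 1) * B.card * (δ / T) with hκ
  have hint : ∀ y ∈ Icc p (p + T), u y - u p
      = κ * (y - p) - (Λ + 1) * ∑ x ∈ B, (block T δ (y - x) - block T δ (p - x)) := by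
    intro y hy
    have hi : ∀ x, IntervalIntegrable (fun z => blockSlope T δ (z - x)) volume p y := fun x => by
      simpa using (intervalIntegrable_blockSlope hδ hδT (p - x) (y - x)).comp_sub_right x
    have hsum : IntervalIntegrable (fun z => ∑ x ∈ B, blockSlope T δ (z - x)) volume p y := by
      simpa only [Finset.sum_fn] using IntervalIntegrable.sum B fun x _ => hi x
    rw [← hu.integral_deriv p y, intervalIntegral.integral_congr_ae
      (g := fun z => κ - (Λ + 1) * ∑ x ∈ B, blockSlope T δ (z - x))]
    · rw [intervalIntegral.integral_sub intervalIntegrable_const (hsum.const_mul _),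
        intervalIntegral.integral_const, intervalIntegral.integral_const_mul,
        intervalIntegral.integral_finsetSum fun x _ => hi x, smul_eq_mul, mul_comm (y - p)]
      congr 2
      refine Finset.sum_congr rfl fun x _ => ?_
      rw [intervalIntegral.integral_comp_sub_right (blockSlope T δ), block_sub hδ hδT]
    · have hne : ∀ᵐ z : ℝ, z ≠ p + T := by
        simpa using (countable_singleton (p + T)).ae_notMem volume
      filter_upwards [hderiv, hne] with z hz hzT hzI
      rw [uIoc_of_le hy.1] at hzI
      exact hz ⟨hzI.1, (hzI.2.trans hy.2).lt_of_ne hzT⟩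
  have hκ0 : κ = 0 := by
    have h := hint (p + T) ⟨by linarith, le_rfl⟩
    rw [hu.per p, sub_self, Finset.sum_eq_zero, mul_zero, sub_zero, add_sub_cancel_left] at h
    · exact (mul_eq_zero.1 h.symm).resolve_right hT0.ne'
    · intro x _
      rw [add_sub_right_comm, block_periodic hδ hδT, sub_self]
  have hcard : B.card = L := by
    have h1 : (B.card : ℝ) * ((Λ + 1) * δ) = L * ((Λ + 1) * δ) := by
      rw [hT]
      rw [hκ] at hκ0
      field_simp at hκ0
      linarith
    exact_mod_cast mul_right_cancel₀ (by positivity) h1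
  obtain ⟨b, hb, hsumb⟩ := exists_sorted_enumeration hBp hsep
  rw [hcard] at hb hsumb
  refine ⟨u p + (Λ + 1) * train T δ L b p, b, fun i j hij hj => ?_, fun x => ?_⟩
  · have := hb i j hij hj
    rwa [show p + T - δ - p = T - δ by ring] at this
  · have hper : Function.Periodic (fun y => u y + (Λ + 1) * train T δ L b y) T := fun y => by
      simp only [hu.per y, train_periodic hδ hδT L b y]
    obtain ⟨y, hy, hxy⟩ := hper.exists_mem_Ico hT0 x p
    have h := hint y (Ico_subset_Icc_self hy)
    rw [hκ0, Finset.sum_sub_distrib, ← hsumb fun x => block T δ (y - x),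
      ← hsumb fun x => block T δ (p - x)] at h
    simp only [train] at hxy ⊢
    linarith

end Structure

section Minimizers

variable {s T Λ δ : ℝ} {u v : ℝ → ℝ}

lemma integral_incr_sq_of_eq_train (hδ : 0 < δ) (hδT : δ < T) {N : ℕ} {b : ℕ → ℝ} {c m a : ℝ}
    (hu : ∀ x, u x = c - m * train T δ N b (x + a)) (h : ℝ) :
    ∫ x in (0 : ℝ)..T, (u (x + h) - u x) ^ 2
      = m ^ 2 * ∫ x in (0 : ℝ)..T, (train T δ N b (x + h) - train T δ N b x) ^ 2 := by
  have hper : Function.Periodic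
      (fun x => (train T δ N b (x + h) - train T δ N b x) ^ 2) T := fun x => by
    simp only [add_right_comm x T h, train_periodic hδ hδT N b _]
  rw [← periodic_integral_comp_add hper a, ← intervalIntegral.integral_const_mul]
  refine intervalIntegral.integral_congr fun x _ => ?_
  simp only [hu, add_right_comm x h a]
  ring

lemma abs_sub_le_of_eq_train (hδ : 0 < δ) (hδT : δ < T) {N : ℕ} {b : ℕ → ℝ} {c m a : ℝ}
    (hm : 0 ≤ m) (hu : ∀ x, u x = c - m * train T δ N b (x + a)) (x y : ℝ) :
    |u y - u x| ≤ m * N * |y - x| := by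
  have h := abs_train_sub_le hδ hδT N b (x + a) (y + a)
  rw [add_sub_add_right_eq_sub] at h
  rw [hu, hu, show c - m * train T δ N b (y + a) - (c - m * train T δ N b (x + a))
    = -(m * (train T δ N b (y + a) - train T δ N b (x + a))) by ring, abs_neg, abs_mul,
    abs_of_nonneg hm, mul_assoc]
  exact mul_le_mul_of_nonneg_left h hm

lemma Admissible.Fs_le_of_eq_ubar (hs : 0 < s) (hs1 : s < 1) (hΛ : 0 < Λ) (hδ : 0 < δ)
    (hδT : δ < T) {L : ℕ} (hL : 0 < L) (hT : L * ((Λ + 1) * δ) = T) (hu : Admissible T Λ δ u)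
    {x₀ y₀ : ℝ} (hux : u = fun x => ubar Λ δ (x - x₀) + y₀) (hv : Admissible T Λ δ v) :
    Fs s T u ≤ Fs s T v := by
  obtain ⟨c, hc⟩ := ubar_eq_train hΛ hδ hδT hL hT
  obtain ⟨c', b, hb, hvb⟩ := hv.exists_train hΛ hδ hδT hT
  have hu' : ∀ x, u x
      = (c + y₀) - (Λ + 1) * train T δ L (fun i => i * ((Λ + 1) * δ)) (x + (δ - x₀)) := fun x => by
    rw [hux]
    rw [show x + (δ - x₀) = x - x₀ + δ by ring]
    simp only [hc]
    ring
  have hv' : ∀ x, v x = c' - (Λ + 1) * train T δ L b (x + 0) := by simpa using hvb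
  have hm : 0 ≤ Λ + 1 := by positivity
  refine Fs_mono hs hs1 (hδ.trans hδT) hu.cont hu.per (abs_sub_le_of_eq_train hδ hδT hm hu')
    hv.cont hv.per (abs_sub_le_of_eq_train hδ hδT hm hv') fun h => ?_
  rw [integral_incr_sq_of_eq_train hδ hδT hu', integral_incr_sq_of_eq_train hδ hδT hv']
  exact mul_le_mul_of_nonneg_left
    (integral_train_incr_sq_ge hδ hδT (by nlinarith) hT hb h) (sq_nonneg _)

lemma Admissible.exists_eq_ubar_of_Fs_le (hs : 0 < s) (hs1 : s < 1) (hΛ : 0 < Λ) (hδ : 0 < δ)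
    (hδT : δ < T) {L : ℕ} (hL : 0 < L) (hT : L * ((Λ + 1) * δ) = T) (hu : Admissible T Λ δ u)
    (hmin : Fs s T u ≤ Fs s T (ubar Λ δ)) :
    ∃ x₀ y₀ : ℝ, u = fun x => ubar Λ δ (x - x₀) + y₀ := by
  obtain ⟨c, hc⟩ := ubar_eq_train hΛ hδ hδT hL hT
  obtain ⟨c', b, hb, hub⟩ := hu.exists_train hΛ hδ hδT hT
  have hu' : ∀ x, u x = c' - (Λ + 1) * train T δ L b (x + 0) := by simpa using hub
  have hm : 0 ≤ Λ + 1 := by positivity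
  have hδd : δ ≤ (Λ + 1) * δ := by nlinarith
  have hbar := admissible_ubar hΛ hδ hT
  have hgap : ∀ k, k + 1 < L → b (k + 1) - b k = (Λ + 1) * δ := by
    intro k hk
    by_contra hne
    refine hmin.not_gt (Fs_strictMono hs hs1 (hδ.trans hδT) hbar.cont hbar.per
      (abs_sub_le_of_eq_train hδ hδT hm hc) hu.cont hu.per
      (abs_sub_le_of_eq_train hδ hδT hm hu') (fun h => ?_) (a := (Λ + 1) * δ - δ)
      (b := (Λ + 1) * δ + δ) (by linarith) (by linarith) fun h hh => ?_)
    · rw [integral_incr_sq_of_eq_train hδ hδT hu', integral_incr_sq_of_eq_train hδ hδT hc]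
      exact mul_le_mul_of_nonneg_left
        (integral_train_incr_sq_ge hδ hδT hδd hT hb h) (sq_nonneg _)
    · rw [integral_incr_sq_of_eq_train hδ hδT hu', integral_incr_sq_of_eq_train hδ hδT hc]
      refine mul_lt_mul_of_pos_left
        (integral_train_incr_sq_gt hδ hδT hδd hT hb ?_ hk hne) (by positivity)
      rw [abs_lt]
      constructor <;> linarith [hh.1, hh.2]
  have hbi : ∀ i, i < L → b i = b 0 + i * ((Λ + 1) * δ) := by
    intro i
    induction i with
    | zero => simp
    | succ k ih =>
      intro hk
      push_cast
      linarith [hgap k hk, ih (Nat.lt_of_succ_lt hk)]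
  refine ⟨b 0 + δ, c' - c, funext fun x => ?_⟩
  have : train T δ L b x
      = train T δ L (fun i => i * ((Λ + 1) * δ)) (x - (b 0 + δ) + δ) := by
    refine Finset.sum_congr rfl fun i hi => ?_
    rw [hbi i (Finset.mem_range.1 hi)]
    congr 1
    ring
  rw [hub, hc, this]
  ring

end Minimizers

/-- The minimizers of `ℱ^T_s` over `𝒜^{T,Λ,δ}` are exactly the translates
`ū(· - x₀) + y₀`; in particular every minimizer is `(Λ+1)δ`-periodic. -/
theorem statement2 (s Λ δ T : ℝ) (L : ℕ)
    (hs : 0 < s) (hs1 : s < 1) (hΛ : 0 < Λ) (hδ : 0 < δ) (hL : 0 < L)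
    (hT : T = (L : ℝ) * ((Λ + 1) * δ))
    (u : ℝ → ℝ) (hu : Admissible T Λ δ u) :
    ((∀ v : ℝ → ℝ, Admissible T Λ δ v → Fs s T u ≤ Fs s T v) ↔
      ∃ x₀ y₀ : ℝ, u = fun x => ubar Λ δ (x - x₀) + y₀) ∧
    ((∀ v : ℝ → ℝ, Admissible T Λ δ v → Fs s T u ≤ Fs s T v) →
      Function.Periodic u ((Λ + 1) * δ)) := by
  have hδT : δ < T := by
    have h1 : (1 : ℝ) ≤ L := by exact_mod_cast hL
    have h2 : δ < (Λ + 1) * δ := by nlinarith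
    rw [hT]
    nlinarith
  have hmin : (∀ v : ℝ → ℝ, Admissible T Λ δ v → Fs s T u ≤ Fs s T v) →
      ∃ x₀ y₀ : ℝ, u = fun x => ubar Λ δ (x - x₀) + y₀ := fun h =>
    hu.exists_eq_ubar_of_Fs_le hs hs1 hΛ hδ hδT hL hT.symm
      (h _ (admissible_ubar hΛ hδ hT.symm))
  refine ⟨⟨hmin, ?_⟩, fun h x => ?_⟩
  · rintro ⟨x₀, y₀, h⟩ v hv
    exact hu.Fs_le_of_eq_ubar hs hs1 hΛ hδ hδT hL hT.symm h hv
  · obtain ⟨x₀, y₀, rfl⟩ := hmin h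
    simp only [add_sub_right_comm, ubar_periodic hΛ hδ _]
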